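/- arXiv:1811.12048 — 9 statements merged into one kernel-verified Lean document; each statement's English description precedes it below -/
import Mathlib

section
/- Let M be a finite nonempty set of vectors in a vector space over ℚ. Say a finite set of vectors is positively dependent if there exist positive integers b_ν indexed by the set with Σ b_ν ν = 0. Assume M is positively dependent and no nonempty proper subset of M is positively dependent. Then there exists exactly one family of positive integers (b_ν)_{ν∈M} with greatest common divisor 1 such that Σ_{ν∈M} b_ν ν = 0. -/
/-- A finite set of vectors is positively dependent if some positive integer combination
of its elements vanishes. -/
def PosDep {E : Type*} [AddCommGroup E] [Module ℚ E] (S : Finset E) : Prop :=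
  ∃ c : E → ℕ, (∀ ν ∈ S, 0 < c ν) ∧ ∑ ν ∈ S, (c ν : ℚ) • ν = 0

/-- If no nonempty proper subset of `M` is positively dependent, a relation with natural
coefficients that vanish somewhere on `M` is trivial. -/
theorem eq_zero_of_sum_natCast_smul_eq_zero {E : Type*} [AddCommGroup E] [Module ℚ E]
    {M : Finset E} (hmin : ∀ S ⊂ M, S.Nonempty → ¬ PosDep S) {c : E → ℕ}
    (hc : ∑ ν ∈ M, (c ν : ℚ) • ν = 0) {μ : E} (hμ : μ ∈ M) (hcμ : c μ = 0)
    {ν : E} (hν : ν ∈ M) : c ν = 0 := by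
  classical
  by_contra hcν
  refine hmin (M.filter fun x ↦ c x ≠ 0)
    (Finset.filter_ssubset.2 ⟨μ, hμ, fun h ↦ h hcμ⟩)
    ⟨ν, Finset.mem_filter.2 ⟨hν, hcν⟩⟩
    ⟨c, fun x hx ↦ Nat.pos_of_ne_zero (Finset.mem_filter.1 hx).2, ?_⟩
  rw [Finset.sum_filter_of_ne, hc]
  intro x _ hx h
  simp [h] at hx

/-- Any two positive relations on a set none of whose nonempty proper subsets is positively
dependent are proportional. -/
theorem exists_forall_mul_eq_mul_of_sum_natCast_smul_eq_zero
    {E : Type*} [AddCommGroup E] [Module ℚ E]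
    {M : Finset E} (hne : M.Nonempty) (hmin : ∀ S ⊂ M, S.Nonempty → ¬ PosDep S) {a b : E → ℕ}
    (hb : ∀ ν ∈ M, 0 < b ν) (ha0 : ∑ ν ∈ M, (a ν : ℚ) • ν = 0)
    (hb0 : ∑ ν ∈ M, (b ν : ℚ) • ν = 0) :
    ∃ μ ∈ M, ∀ ν ∈ M, b μ * a ν = a μ * b ν := by
  obtain ⟨μ, hμ, hmu⟩ := M.exists_min_image (fun ν ↦ (a ν : ℚ) / b ν) hne
  have hle : ∀ ν ∈ M, a μ * b ν ≤ b μ * a ν := by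
    intro ν hν
    have h := hmu ν hν
    rw [div_le_div_iff₀ (by exact_mod_cast hb μ hμ) (by exact_mod_cast hb ν hν)] at h
    rw [mul_comm (b μ)]
    exact_mod_cast h
  refine ⟨μ, hμ, fun ν hν ↦ le_antisymm (Nat.sub_eq_zero_iff_le.1 ?_) (hle ν hν)⟩
  refine eq_zero_of_sum_natCast_smul_eq_zero (c := fun ν ↦ b μ * a ν - a μ * b ν) hmin ?_ hμ
    (by simp [mul_comm]) hν
  calc ∑ ν ∈ M, ((b μ * a ν - a μ * b ν : ℕ) : ℚ) • ν
      = ∑ ν ∈ M, ((b μ : ℚ) • (a ν : ℚ) • ν - (a μ : ℚ) • (b ν : ℚ) • ν) := by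
        refine Finset.sum_congr rfl fun ν hν ↦ ?_
        rw [Nat.cast_sub (hle ν hν), Nat.cast_mul, Nat.cast_mul, sub_smul, mul_smul, mul_smul]
    _ = 0 := by
        rw [Finset.sum_sub_distrib, ← Finset.smul_sum, ← Finset.smul_sum, ha0, hb0]
        simp

/-- A balanced simplex (a positively dependent finite set of vectors, no nonempty proper
subset of which is positively dependent) has a unique family of positive integer
coefficients with gcd 1 witnessing the dependence. -/
theorem balanced_simplex_unique_primitive_coeffs
    {E : Type*} [AddCommGroup E] [Module ℚ E] (M : Finset E)
    (hne : M.Nonempty) (hdep : PosDep M)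
    (hmin : ∀ S ⊂ M, S.Nonempty → ¬ PosDep S) :
    ∃! b : E → ℕ, (∀ ν, ν ∉ M → b ν = 0) ∧ (∀ ν ∈ M, 0 < b ν) ∧
      M.gcd b = 1 ∧ ∑ ν ∈ M, (b ν : ℚ) • ν = 0 := by
  classical
  refine existsUnique_of_exists_of_unique ?_ ?_
  · obtain ⟨c, hc, hc0⟩ := hdep
    obtain ⟨g, hg, hg1⟩ := Finset.extract_gcd c hne
    have hgpos : ∀ ν ∈ M, 0 < M.gcd c ∧ 0 < g ν := fun ν hν ↦ by
      have h := hc ν hν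
      rw [hg ν hν] at h
      exact ⟨Nat.pos_of_mul_pos_right h, Nat.pos_of_mul_pos_left h⟩
    refine ⟨fun ν ↦ if ν ∈ M then g ν else 0, fun ν hν ↦ if_neg hν, fun ν hν ↦ ?_, ?_, ?_⟩
    · simpa [hν] using (hgpos ν hν).2
    · rw [← hg1]
      exact Finset.gcd_congr rfl fun ν hν ↦ if_pos hν
    · obtain ⟨μ, hμ⟩ := hne
      have hd : ((M.gcd c : ℕ) : ℚ) ≠ 0 := by exact_mod_cast (hgpos μ hμ).1.ne'
      refine (smul_eq_zero.1 ?_).resolve_left hd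
      rw [Finset.smul_sum, ← hc0]
      refine Finset.sum_congr rfl fun ν hν ↦ ?_
      simp only [if_pos hν]
      rw [hg ν hν, Nat.cast_mul, mul_smul]
  · rintro a b ⟨haM, -, ha1, ha0⟩ ⟨hbM, hb, hb1, hb0⟩
    obtain ⟨μ, hμ, h⟩ := exists_forall_mul_eq_mul_of_sum_natCast_smul_eq_zero hne hmin hb ha0 hb0
    have hab : b μ = a μ := by
      have hgcd := Finset.gcd_congr (s₁ := M) rfl h
      simpa [Finset.gcd_mul_left, ha1, hb1] using hgcd
    funext ν
    by_cases hν : ν ∈ M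
    · exact Nat.eq_of_mul_eq_mul_left (hb μ hμ) (by rw [h ν hν, hab])
    · rw [haM ν hν, hbM ν hν]
end

section
/- Let M be a finite nonempty set of vectors in a vector space over ℚ that is a balanced simplex, with primitive coefficients (b_ν)_{ν∈M} (positive integers with gcd 1 and Σ b_ν ν = 0). Then every family (a_ν)_{ν∈M} of natural numbers satisfying Σ_{ν∈M} a_ν ν = 0 is of the form a_ν = q·b_ν for some natural number q. -/
/-- If no nonempty proper subset of `M` is positively dependent, a nonnegative relation on `M`
with a zero coefficient is trivial. -/
theorem eq_zero_of_sum_smul_eq_zero_of_not_posDep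
    {E : Type*} [AddCommGroup E] [Module ℚ E] {M : Finset E}
    (hmin : ∀ S ⊂ M, S.Nonempty → ¬ PosDep S) {c : E → ℕ}
    (hc : ∑ ν ∈ M, (c ν : ℚ) • ν = 0) {μ : E} (hμ : μ ∈ M) (hcμ : c μ = 0) :
    ∀ ν ∈ M, c ν = 0 := by
  intro ν hν
  by_contra hcν
  refine hmin (M.filter (c · ≠ 0)) (Finset.filter_ssubset.2 ⟨μ, hμ, by simpa using hcμ⟩)
    ⟨ν, by simp [hν, hcν]⟩ ⟨c, fun x hx ↦ Nat.pos_of_ne_zero (Finset.mem_filter.1 hx).2, ?_⟩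
  rw [Finset.sum_filter_of_ne, hc]
  intro x _ hx h
  simp [h] at hx

/-- For a balanced simplex `M` with primitive coefficients `b` (positive integers with
gcd 1 and `∑ b_ν • ν = 0`), every family of natural numbers `a` with `∑ a_ν • ν = 0`
is a natural multiple of `b`. -/
theorem balanced_simplex_relations_are_multiples
    {E : Type*} [AddCommGroup E] [Module ℚ E] (M : Finset E)
    (hne : M.Nonempty)
    (hmin : ∀ S ⊂ M, S.Nonempty → ¬ PosDep S)
    (b : E → ℕ) (hbpos : ∀ ν ∈ M, 0 < b ν) (hgcd : M.gcd b = 1)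
    (hbsum : ∑ ν ∈ M, (b ν : ℚ) • ν = 0)
    (a : E → ℕ) (hasum : ∑ ν ∈ M, (a ν : ℚ) • ν = 0) :
    ∃ q : ℕ, ∀ ν ∈ M, a ν = q * b ν := by
  obtain ⟨μ, hμ, hle⟩ := M.exists_min_image (fun ν ↦ (a ν : ℚ) / b ν) hne
  have hle' : ∀ ν ∈ M, a μ * b ν ≤ b μ * a ν := fun ν hν ↦ by
    have h := hle ν hν
    rw [div_le_div_iff₀ (by exact_mod_cast hbpos μ hμ) (by exact_mod_cast hbpos ν hν)] at h
    rw [mul_comm (b μ)]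
    exact_mod_cast h
  have hsum : ∑ ν ∈ M, ((b μ * a ν - a μ * b ν : ℕ) : ℚ) • ν = 0 := by
    calc ∑ ν ∈ M, ((b μ * a ν - a μ * b ν : ℕ) : ℚ) • ν
        = ∑ ν ∈ M, ((b μ : ℚ) • (a ν : ℚ) • ν - (a μ : ℚ) • (b ν : ℚ) • ν) :=
          Finset.sum_congr rfl fun ν hν ↦ by
            rw [Nat.cast_sub (hle' ν hν), sub_smul, Nat.cast_mul, Nat.cast_mul, mul_smul, mul_smul]
      _ = 0 := by
          rw [Finset.sum_sub_distrib, ← Finset.smul_sum, ← Finset.smul_sum, hasum, hbsum]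
          simp
  have heq : ∀ ν ∈ M, b μ * a ν = a μ * b ν := fun ν hν ↦
    le_antisymm (Nat.sub_eq_zero_iff_le.1 (eq_zero_of_sum_smul_eq_zero_of_not_posDep hmin hsum hμ
      (by rw [mul_comm, Nat.sub_self]) ν hν)) (hle' ν hν)
  have hdvd : b μ ∣ a μ := by
    have h : b μ ∣ M.gcd fun ν ↦ a μ * b ν :=
      Finset.dvd_gcd fun ν hν ↦ ⟨a ν, (heq ν hν).symm⟩
    simpa [Finset.gcd_mul_left, hgcd] using h
  obtain ⟨q, hq⟩ := hdvd
  refine ⟨q, fun ν hν ↦ Nat.eq_of_mul_eq_mul_left (hbpos μ hμ) ?_⟩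
  rw [heq ν hν, hq, mul_assoc]
end

section
/- Let ι be a finite index set, E a vector space over ℚ, and ν : ι → E a family of vectors (the weights). Let M ⊆ ι be a nonempty subset and (b_i)_{i∈M} positive integers with Σ_{i∈M} b_i ν_i = 0, such that no nonempty proper subset S ⊊ M admits positive integers (c_i)_{i∈S} with Σ_{i∈S} c_i ν_i = 0, and gcd{b_i : i ∈ M} = 1. Consider the additive monoid N = {a : ι → ℕ | Σ_{i∈ι} a_i ν_i = 0}. Then the element b̂ ∈ N defined by b̂_i = b_i for i ∈ M and b̂_i = 0 otherwise is an atom of N: whenever b̂ = a' + a'' with a', a'' ∈ N, either a' = 0 or a'' = 0. -/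
/-- Any nonnegative integral dependence supported on a balanced simplex is proportional to a given
positive one. -/
theorem exists_cross_mul_eq_of_minimal_dependence
    {ι : Type*} {E : Type*} [AddCommGroup E] [Module ℚ E]
    (ν : ι → E) (M : Finset ι) (hne : M.Nonempty)
    (b : ι → ℕ) (hbpos : ∀ i ∈ M, 0 < b i)
    (hbsum : ∑ i ∈ M, (b i : ℚ) • ν i = 0)
    (hmin : ∀ S ⊂ M, S.Nonempty →
      ¬ ∃ c : ι → ℕ, (∀ i ∈ S, 0 < c i) ∧ ∑ i ∈ S, (c i : ℚ) • ν i = 0)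
    (a : ι → ℕ) (hasum : ∑ i ∈ M, (a i : ℚ) • ν i = 0) :
    ∃ i ∈ M, ∀ j ∈ M, a i * b j = b i * a j := by
  obtain ⟨i, hi, hmax⟩ := M.exists_max_image (fun i => (a i : ℚ) / b i) hne
  have hle : ∀ j ∈ M, b i * a j ≤ a i * b j := by
    intro j hj
    have h := hmax j hj
    have hbi : (0 : ℚ) < b i := by exact_mod_cast hbpos i hi
    have hbj : (0 : ℚ) < b j := by exact_mod_cast hbpos j hj
    rw [div_le_div_iff₀ hbj hbi] at h
    rw [mul_comm (b i)]
    exact_mod_cast h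
  refine ⟨i, hi, ?_⟩
  let c : ι → ℕ := fun j => a i * b j - b i * a j
  have hcsum : ∑ j ∈ M, (c j : ℚ) • ν j = 0 := by
    have h : ∀ j ∈ M, (c j : ℚ) • ν j
        = (a i : ℚ) • ((b j : ℚ) • ν j) - (b i : ℚ) • ((a j : ℚ) • ν j) := by
      intro j hj
      simp only [c]
      rw [Nat.cast_sub (hle j hj), smul_smul, smul_smul, ← sub_smul]
      push_cast
      rfl
    rw [Finset.sum_congr rfl h, Finset.sum_sub_distrib, ← Finset.smul_sum, ← Finset.smul_sum,
      hbsum, hasum, smul_zero, smul_zero, sub_zero]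
  have hci : c i = 0 := by simp [c, mul_comm]
  have hssub : M.filter (fun j => 0 < c j) ⊂ M :=
    Finset.filter_ssubset.2 ⟨i, hi, by omega⟩
  have hempty : ¬ (M.filter (fun j => 0 < c j)).Nonempty := fun hS =>
    hmin _ hssub hS ⟨c, fun j hj => (Finset.mem_filter.1 hj).2, by
      rw [Finset.sum_filter_of_ne, hcsum]
      intro j _ hj
      by_contra h0
      exact hj (by simp [Nat.eq_zero_of_not_pos h0])⟩
  intro j hj
  refine le_antisymm ?_ (hle j hj)
  by_contra hlt
  exact hempty ⟨j, Finset.mem_filter.2 ⟨hj, Nat.sub_pos_of_lt (not_le.1 hlt)⟩⟩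

/-- The element of the monoid `N = {a : ι → ℕ | ∑ a_i • ν_i = 0}` given by the primitive
coefficients of a balanced simplex `M` (extended by zero off `M`) is an atom of `N`. -/
theorem balanced_simplex_coeffs_atom
    {ι : Type*} [Fintype ι] [DecidableEq ι] {E : Type*} [AddCommGroup E] [Module ℚ E]
    (ν : ι → E) (M : Finset ι) (hne : M.Nonempty)
    (b : ι → ℕ) (hbpos : ∀ i ∈ M, 0 < b i)
    (hbsum : ∑ i ∈ M, (b i : ℚ) • ν i = 0)
    (hmin : ∀ S ⊂ M, S.Nonempty →
      ¬ ∃ c : ι → ℕ, (∀ i ∈ S, 0 < c i) ∧ ∑ i ∈ S, (c i : ℚ) • ν i = 0)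
    (hgcd : M.gcd b = 1)
    (a' a'' : ι → ℕ)
    (ha' : ∑ i, (a' i : ℚ) • ν i = 0) (ha'' : ∑ i, (a'' i : ℚ) • ν i = 0)
    (hsplit : ∀ i, (if i ∈ M then b i else 0) = a' i + a'' i) :
    a' = 0 ∨ a'' = 0 := by
  have hoff : ∀ i ∉ M, a' i = 0 ∧ a'' i = 0 := by
    intro i hi
    have h := hsplit i
    rw [if_neg hi] at h
    omega
  have hon : ∀ i ∈ M, b i = a' i + a'' i := by
    intro i hi
    simpa [hi] using hsplit i
  have hasum : ∑ i ∈ M, (a' i : ℚ) • ν i = 0 := by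
    rw [← ha']
    refine Finset.sum_subset M.subset_univ fun i _ hi => ?_
    simp [(hoff i hi).1]
  obtain ⟨i, hi, hprop⟩ :=
    exists_cross_mul_eq_of_minimal_dependence ν M hne b hbpos hbsum hmin a' hasum
  have hdvd : b i ∣ a' i := by
    have h : b i ∣ M.gcd (fun j => a' i * b j) :=
      Finset.dvd_gcd fun j hj => ⟨a' j, hprop j hj⟩
    simpa [Finset.gcd_mul_left, hgcd] using h
  have hbi := hbpos i hi
  rcases Nat.eq_zero_or_pos (a' i) with h0 | hpos
  · left
    funext j
    by_cases hj : j ∈ M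
    · have h := hprop j hj
      rw [h0, zero_mul] at h
      exact (mul_eq_zero.1 h.symm).resolve_left hbi.ne'
    · exact (hoff j hj).1
  · right
    have heq : a' i = b i :=
      le_antisymm (by have := hon i hi; omega) (Nat.le_of_dvd hpos hdvd)
    funext j
    by_cases hj : j ∈ M
    · have h := hprop j hj
      rw [heq] at h
      have hbj := Nat.eq_of_mul_eq_mul_left hbi h
      have := hon j hj
      simp only [Pi.zero_apply]
      omega
    · exact (hoff j hj).2
end

section
/- Let ν : Fin m → (Fin k → ℚ) be a family of weight vectors. Call a monomial X^a = ∏_i X_i^{a_i} in MvPolynomial (Fin m) ℂ invariant if Σ_i a_i ν_i = 0, and let A be the ℂ-linear span of the invariant monomials (a subalgebra, the torus invariant ring). Suppose M ⊆ Fin m is nonempty and (b_i)_{i∈M} are positive integers with gcd 1 such that Σ_{i∈M} b_i ν_i = 0 and no nonempty proper subset S ⊊ M admits positive integers (c_i)_{i∈S} with Σ_{i∈S} c_i ν_i = 0. Then the monomial ∏_{i∈M} X_i^{b_i} lies in A but does not lie in the subalgebra of MvPolynomial (Fin m) ℂ generated by the elements of A of total degree strictly less than Σ_{i∈M} b_i.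 In particular, the invariant ring A admits a generator of degree b_M = Σ_{i∈M} b_i. -/
/-- On a balanced simplex, a nonzero natural dependence dominated by the primitive one
dominates it in turn. -/
theorem balancedSimplex_le_of_dependence {ι V : Type*} [AddCommGroup V] [Module ℚ V]
    (ν : ι → V) (M : Finset ι) (b : ι → ℕ) (hbpos : ∀ i ∈ M, 0 < b i) (hgcd : M.gcd b = 1)
    (hbsum : ∑ i ∈ M, (b i : ℚ) • ν i = 0)
    (hmin : ∀ S ⊂ M, S.Nonempty →
      ¬ ∃ c : ι → ℕ, (∀ i ∈ S, 0 < c i) ∧ ∑ i ∈ S, (c i : ℚ) • ν i = 0)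
    (a : ι → ℕ) (ha : ∃ i ∈ M, a i ≠ 0) (hasum : ∑ i ∈ M, (a i : ℚ) • ν i = 0) :
    ∀ i ∈ M, b i ≤ a i := by
  classical
  -- A dependence on `M` vanishing at one vertex vanishes at every vertex.
  have vanish : ∀ c : ι → ℕ, ∑ i ∈ M, (c i : ℚ) • ν i = 0 → (∃ i ∈ M, c i = 0) →
      ∀ i ∈ M, c i = 0 := by
    rintro c hc ⟨j, hj, hcj⟩ i hi
    by_contra hci
    refine hmin (M.filter fun i => c i ≠ 0) ?_ ⟨i, by simp [hi, hci]⟩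
      ⟨c, fun i hi => Nat.pos_of_ne_zero (Finset.mem_filter.mp hi).2, ?_⟩
    · exact Finset.filter_ssubset.mpr ⟨j, hj, by simp [hcj]⟩
    · rw [← hc]
      refine Finset.sum_filter_of_ne fun i _ h h0 => h (by simp [h0])
  have hapos : ∀ i ∈ M, 0 < a i := by
    intro i hi
    by_contra h
    obtain ⟨j, hj, hne⟩ := ha
    exact hne (vanish a hasum ⟨i, hi, by omega⟩ j hj)
  obtain ⟨i₁, hi₁, -⟩ := ha
  obtain ⟨j, hj, hjmin⟩ := M.exists_min_image (fun i => (b i : ℚ) / a i) ⟨i₁, hi₁⟩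
  have hle : ∀ i ∈ M, b j * a i ≤ a j * b i := by
    intro i hi
    have h := hjmin i hi
    rw [div_le_div_iff₀ (by exact_mod_cast hapos j hj) (by exact_mod_cast hapos i hi)] at h
    rw [mul_comm (a j)]
    exact_mod_cast h
  have hprop : ∀ i ∈ M, a j * b i = b j * a i := by
    intro i hi
    have h := vanish (fun i => a j * b i - b j * a i) ?_ ⟨j, hj, by simp [mul_comm]⟩ i hi
    · have := hle i hi
      omega
    · calc ∑ i ∈ M, ((a j * b i - b j * a i : ℕ) : ℚ) • ν i
          = ∑ i ∈ M, ((a j : ℚ) • (b i : ℚ) • ν i - (b j : ℚ) • (a i : ℚ) • ν i) := by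
            refine Finset.sum_congr rfl fun i hi => ?_
            rw [Nat.cast_sub (hle i hi), sub_smul, Nat.cast_mul, Nat.cast_mul, mul_smul, mul_smul]
        _ = 0 := by
            rw [Finset.sum_sub_distrib, ← Finset.smul_sum, ← Finset.smul_sum, hbsum, hasum]
            simp
  have hdvd : b j ∣ a j := by
    have h : b j ∣ M.gcd fun i => a j * b i :=
      Finset.dvd_gcd fun i hi => ⟨a i, hprop i hi⟩
    simpa [Finset.gcd_mul_left, hgcd] using h
  intro i hi
  refine Nat.le_of_mul_le_mul_left ?_ (hbpos j hj)
  rw [← hprop i hi]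
  exact Nat.mul_le_mul_right _ (Nat.le_of_dvd (hapos j hj) hdvd)

/-- If no generator has a nonconstant term dividing `X ^ β`, neither does any element of the
generated subalgebra. -/
theorem MvPolynomial.coeff_eq_zero_of_mem_adjoin {σ R : Type*} [CommSemiring R] (β : σ →₀ ℕ)
    {s : Set (MvPolynomial σ R)} (hs : ∀ f ∈ s, ∀ a ≤ β, a ≠ 0 → f.coeff a = 0)
    {f : MvPolynomial σ R} (hf : f ∈ Algebra.adjoin R s) : ∀ a ≤ β, a ≠ 0 → f.coeff a = 0 := by
  classical
  induction hf using Algebra.adjoin_induction with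
  | mem f hf => exact hs f hf
  | algebraMap r =>
    intro a _ ha
    rw [MvPolynomial.algebraMap_eq, MvPolynomial.coeff_C, if_neg ha.symm]
  | add f g _ _ hf hg =>
    intro a hle ha
    rw [MvPolynomial.coeff_add, hf a hle ha, hg a hle ha, add_zero]
  | mul f g _ _ hf hg =>
    intro a hle ha
    rw [MvPolynomial.coeff_mul]
    refine Finset.sum_eq_zero fun x hx => ?_
    rw [Finset.HasAntidiagonal.mem_antidiagonal] at hx
    by_cases h : x.1 = 0
    · rw [hg x.2 ((hx ▸ le_add_self).trans hle) (by rintro h'; simp_all), mul_zero]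
    · rw [hf x.1 ((hx ▸ le_self_add).trans hle) h, zero_mul]

/-- The exponents occurring in an element of the span of a set of monomials are among the
exponents of these monomials. -/
theorem MvPolynomial.exponent_of_mem_span_monomial {σ R : Type*} [CommSemiring R]
    {P : (σ →₀ ℕ) → Prop} {f : MvPolynomial σ R}
    (hf : f ∈ Submodule.span R {p | ∃ a, P a ∧ p = MvPolynomial.monomial a 1})
    {a : σ →₀ ℕ} (ha : f.coeff a ≠ 0) : P a := by
  classical
  contrapose! ha
  induction hf using Submodule.span_induction with
  | mem f hf =>
    obtain ⟨c, hc, rfl⟩ := hf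
    rw [MvPolynomial.coeff_monomial, if_neg]
    rintro rfl
    exact ha hc
  | zero => simp
  | add f g _ _ hf hg => rw [MvPolynomial.coeff_add, hf, hg, add_zero]
  | smul r f _ hf => rw [MvPolynomial.coeff_smul, hf, smul_zero]

/-- Torus case of the paper's Theorem 1: for a torus acting diagonally on `ℂ^m` with
weights `ν i`, the invariant ring `A` (the span of the invariant monomials) admits a
generator of degree `b_M = ∑_{i ∈ M} b i`, where `M` is a balanced simplex of weights
with primitive coefficients `b`: the monomial `∏_{i ∈ M} X i ^ b i` is invariant but is
not in the subalgebra generated by the invariants of strictly smaller total degree. -/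
theorem torus_invariant_generator_of_balanced_simplex
    {m k : ℕ} (ν : Fin m → (Fin k → ℚ))
    (A : Submodule ℂ (MvPolynomial (Fin m) ℂ))
    (hA : A = Submodule.span ℂ
      {p : MvPolynomial (Fin m) ℂ | ∃ a : Fin m →₀ ℕ,
        (∑ i, (a i : ℚ) • ν i = 0) ∧ p = MvPolynomial.monomial a 1})
    (M : Finset (Fin m)) (hne : M.Nonempty)
    (b : Fin m → ℕ) (hbpos : ∀ i ∈ M, 0 < b i) (hgcd : M.gcd b = 1)
    (hbsum : ∑ i ∈ M, (b i : ℚ) • ν i = 0)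
    (hmin : ∀ S ⊂ M, S.Nonempty →
      ¬ ∃ c : Fin m → ℕ, (∀ i ∈ S, 0 < c i) ∧ ∑ i ∈ S, (c i : ℚ) • ν i = 0) :
    (∏ i ∈ M, (MvPolynomial.X i : MvPolynomial (Fin m) ℂ) ^ b i) ∈ A ∧
    (∏ i ∈ M, (MvPolynomial.X i : MvPolynomial (Fin m) ℂ) ^ b i) ∉
      Algebra.adjoin ℂ
        {f : MvPolynomial (Fin m) ℂ | f ∈ A ∧ f.totalDegree < ∑ i ∈ M, b i} := by
  classical
  set β : Fin m →₀ ℕ := ∑ i ∈ M, Finsupp.single i (b i) with hβdef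
  have hβ : ∀ i, β i = if i ∈ M then b i else 0 := by
    intro i
    simp [hβdef, Finsupp.finsetSum_apply, Finsupp.single_apply]
  have hprod : (∏ i ∈ M, (MvPolynomial.X i : MvPolynomial (Fin m) ℂ) ^ b i)
      = MvPolynomial.monomial β 1 := by
    simp [hβdef, MvPolynomial.monomial_sum_one, MvPolynomial.X_pow_eq_monomial]
  have hsum : ∀ a ≤ β, ∑ i, (a i : ℚ) • ν i = ∑ i ∈ M, (a i : ℚ) • ν i := by
    intro a hle
    refine (Finset.sum_subset M.subset_univ fun i _ hi => ?_).symm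
    have h := hle i
    rw [hβ, if_neg hi, Nat.le_zero] at h
    simp [h]
  have hβne : β ≠ 0 := by
    obtain ⟨i, hi⟩ := hne
    intro h
    have h' := hβ i
    rw [h, if_pos hi] at h'
    exact (hbpos i hi).ne h'
  rw [hprod, hA]
  refine ⟨Submodule.subset_span ⟨β, ?_, rfl⟩, fun hmem => ?_⟩
  · rw [hsum β le_rfl, ← hbsum]
    refine Finset.sum_congr rfl fun i hi => ?_
    rw [hβ, if_pos hi]
  · suffices h : (MvPolynomial.monomial β (1 : ℂ)).coeff β = 0 by simp at h
    refine MvPolynomial.coeff_eq_zero_of_mem_adjoin β ?_ hmem β le_rfl hβne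
    rintro f ⟨hf, hdeg⟩ a hle ha
    by_contra hcoeff
    have hinv := MvPolynomial.exponent_of_mem_span_monomial hf hcoeff
    rw [hsum a hle] at hinv
    have hex : ∃ i ∈ M, a i ≠ 0 := by
      obtain ⟨i, hi⟩ := Finsupp.ne_iff.mp ha
      refine ⟨i, ?_, hi⟩
      by_contra hiM
      have h := hle i
      rw [hβ, if_neg hiM, Nat.le_zero] at h
      exact hi h
    have hba := balancedSimplex_le_of_dependence ν M b hbpos hgcd hbsum hmin a hex hinv
    refine hdeg.not_ge ?_
    calc ∑ i ∈ M, b i ≤ ∑ i ∈ M, a i := Finset.sum_le_sum hba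
      _ ≤ ∑ i, a i := Finset.sum_le_sum_of_subset M.subset_univ
      _ = a.sum fun _ e => e := (Finsupp.sum_fintype a (fun _ e => e) fun _ => rfl).symm
      _ ≤ f.totalDegree := MvPolynomial.le_totalDegree (MvPolynomial.mem_support_iff.mpr hcoeff)
end

section
/- Let n ≥ 1, let S ⊆ (Fin n → ℂ) be a subset closed under scalar multiplication (c • x ∈ S for all c ∈ ℂ, x ∈ S) whose ℂ-linear span is all of Fin n → ℂ. Let r ≥ 1 and let f ∈ MvPolynomial (Fin n) ℂ be homogeneous of degree d with d ≤ r. If f(x₁ + x₂ + ⋯ + x_r) = 0 for all x₁, …, x_r ∈ S, then f = 0. -/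
namespace MvPolynomial

/-- Setting the variables outside `s` to zero keeps the coefficients of the monomials
supported on `s`. -/
theorem coeff_bind₁_ite_mem {σ R : Type*} [CommSemiring R] [DecidableEq σ] (s : Finset σ)
    (m : σ →₀ ℕ) (hm : m.support ⊆ s) (p : MvPolynomial σ R) :
    coeff m (bind₁ (fun i ↦ if i ∈ s then X i else 0) p) = coeff m p := by
  induction p using MvPolynomial.induction_on' with
  | add p q hp hq => rw [map_add, coeff_add, coeff_add, hp, hq]
  | monomial k a =>
    rw [bind₁_monomial]
    by_cases hk : k.support ⊆ s
    · rw [monomial_eq, Finsupp.prod]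
      congr 2
      exact Finset.prod_congr rfl fun i hi ↦ by rw [if_pos (hk hi)]
    · obtain ⟨i, hi, his⟩ := Finset.not_subset.1 hk
      have hkm : k ≠ m := by
        rintro rfl
        exact hk hm
      rw [Finset.prod_eq_zero hi, mul_zero, coeff_zero, coeff_monomial, if_neg hkm]
      rw [if_neg his, zero_pow (Finsupp.mem_support_iff.1 hi)]

/-- A homogeneous polynomial of degree `d ≤ r` vanishing at all points with at most `r` nonzero
coordinates is zero. -/
theorem IsHomogeneous.eq_zero_of_eval_eq_zero_of_card_le {σ R : Type*} [CommRing R] [IsDomain R]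
    [Infinite R] {d r : ℕ} (hd : d ≤ r) {p : MvPolynomial σ R} (hp : p.IsHomogeneous d)
    (h : ∀ (s : Finset σ) (t : σ → R), s.card ≤ r → (∀ i ∉ s, t i = 0) → eval t p = 0) :
    p = 0 := by
  classical
  ext m
  rw [coeff_zero]
  by_contra hm
  have hcard : m.support.card ≤ r := by
    refine le_trans ?_ hd
    rw [hp.degree_eq_sum_deg_support (mem_support_iff.2 hm), Finset.card_eq_sum_ones]
    exact Finset.sum_le_sum fun i hi ↦ Nat.one_le_iff_ne_zero.2 (Finsupp.mem_support_iff.1 hi)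
  apply hm
  rw [← coeff_bind₁_ite_mem m.support m subset_rfl p]
  have hzero : bind₁ (fun i ↦ if i ∈ m.support then X i else 0) p = 0 := by
    refine MvPolynomial.funext fun t ↦ ?_
    rw [map_zero, ← coe_aeval_eq_eval, RingHom.coe_coe, aeval_bind₁]
    refine h m.support _ hcard fun i hi ↦ ?_
    rw [if_neg hi, map_zero]
  rw [hzero, coeff_zero]

end MvPolynomial

/-- A sum of at most `r` elements of a set containing zero is a sum of `r` elements of it. -/
theorem Finset.exists_fin_sum_eq_of_card_le {ι M : Type*} [AddCommMonoid M] {S : Set M}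
    (h0 : 0 ∈ S) {r : ℕ} (s : Finset ι) (hs : s.card ≤ r) (v : ι → M) (hv : ∀ i, v i ∈ S) :
    ∃ x : Fin r → M, (∀ j, x j ∈ S) ∧ ∑ j, x j = ∑ i ∈ s, v i := by
  obtain ⟨e⟩ : Nonempty (s ↪ Fin r) := Function.Embedding.nonempty_of_card_le (by simpa using hs)
  refine ⟨Function.extend e (fun i ↦ v i) 0, fun j ↦ ?_, ?_⟩
  · by_cases hj : ∃ i, e i = j
    · obtain ⟨i, rfl⟩ := hj
      rw [e.injective.extend_apply]
      exact hv i
    · rwa [Function.extend_apply' _ _ _ hj]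
  · rw [← Finset.sum_coe_sort s]
    refine (Fintype.sum_of_injective e e.injective _ _ (fun j hj ↦ ?_) fun i ↦ ?_).symm
    · exact Function.extend_apply' _ _ _ hj
    · rw [e.injective.extend_apply]


/-- Landsberg–Manivel: for a nondegenerate cone `S` spanning the ambient space, a
homogeneous polynomial of degree `d ≤ r` vanishing on all sums of `r` elements of `S`
is zero; i.e. `I_r(σ_r(X)) = 0`. -/
theorem homogeneous_vanishing_on_secant_eq_zero
    {n : ℕ} (hn : 1 ≤ n) (S : Set (Fin n → ℂ))
    (hcone : ∀ (c : ℂ), ∀ x ∈ S, c • x ∈ S)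
    (hspan : Submodule.span ℂ S = ⊤)
    {r d : ℕ} (hr : 1 ≤ r) (hd : d ≤ r)
    (f : MvPolynomial (Fin n) ℂ) (hf : f.IsHomogeneous d)
    (hvan : ∀ x : Fin r → (Fin n → ℂ), (∀ j, x j ∈ S) →
      MvPolynomial.eval (∑ j, x j) f = 0) :
    f = 0 := by
  classical
  let b := Module.Basis.ofSpan hspan.ge
  have hb : ∀ i, b i ∈ S := fun i ↦ Module.Basis.ofSpan_subset hspan.ge ⟨i, rfl⟩
  let : Fintype _ := FiniteDimensional.fintypeBasisIndex b
  have h0 : (0 : Fin n → ℂ) ∈ S := by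
    have : Nonempty (Fin n) := ⟨⟨0, hn⟩⟩
    obtain ⟨i⟩ := b.index_nonempty
    simpa using hcone 0 _ (hb i)
  let L : Fin n → MvPolynomial _ ℂ := fun k ↦ ∑ i, MvPolynomial.C (b i k) * MvPolynomial.X i
  have heval : ∀ t, MvPolynomial.eval t (MvPolynomial.aeval L f) =
      MvPolynomial.eval (∑ i, t i • b i) f := fun t ↦ by
    rw [← MvPolynomial.coe_aeval_eq_eval, RingHom.coe_coe, ← MvPolynomial.bind₁,
      MvPolynomial.aeval_bind₁, MvPolynomial.aeval_eq_eval]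
    congr 2
    ext k
    simp [L, mul_comm]
  have hL : MvPolynomial.aeval L f = 0 := by
    have hhom : (MvPolynomial.aeval L f).IsHomogeneous (1 * d) :=
      hf.aeval L fun k ↦ MvPolynomial.IsHomogeneous.sum _ _ _ fun i _ ↦
        MvPolynomial.isHomogeneous_C_mul_X _ _
    refine hhom.eq_zero_of_eval_eq_zero_of_card_le (r := r) (by rwa [one_mul])
      fun s t hs ht ↦ ?_
    obtain ⟨x, hx, hsum⟩ := Finset.exists_fin_sum_eq_of_card_le h0 s hs (fun i ↦ t i • b i)
      fun i ↦ hcone _ _ (hb i)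
    rw [heval, ← hvan x hx, hsum]
    congr 2
    refine (Finset.sum_subset s.subset_univ fun i _ hi ↦ ?_).symm
    rw [ht i hi, zero_smul]
  refine MvPolynomial.funext fun y ↦ ?_
  rw [map_zero, ← b.sum_repr y, ← heval, hL, map_zero]
end

section
/- Let n ≥ 1, let S ⊆ (Fin n → ℂ) be a subset closed under scalar multiplication (c • x ∈ S for all c ∈ ℂ, x ∈ S). Let r ≥ 2 and let f ∈ MvPolynomial (Fin n) ℂ be homogeneous of degree r + 1. Suppose that every iterated partial derivative of f of total order r − 1 (in any r − 1 coordinate directions, with repetition allowed) vanishes at every point of S. Then f(x₁ + x₂ + ⋯ + x_r) = 0 for all x₁, …, x_r ∈ S. -/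
namespace MvPolynomial

variable {σ τ K : Type*}

/-- The polynomials all of whose iterated partial derivatives of order `k` lie in `A`. -/
noncomputable def prolongation [CommSemiring K] (A : Submodule K (MvPolynomial σ K)) :
    ℕ → Submodule K (MvPolynomial σ K)
  | 0 => A
  | k + 1 => ⨅ i, (prolongation A k).comap (pderiv i).toLinearMap

@[simp]
theorem mem_prolongation_zero [CommSemiring K] {A : Submodule K (MvPolynomial σ K)}
    {g : MvPolynomial σ K} : g ∈ prolongation A 0 ↔ g ∈ A := Iff.rfl

theorem mem_prolongation_succ [CommSemiring K] {A : Submodule K (MvPolynomial σ K)} {k : ℕ}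
    {g : MvPolynomial σ K} :
    g ∈ prolongation A (k + 1) ↔ ∀ i, pderiv i g ∈ prolongation A k := by
  simp [prolongation]

theorem mem_prolongation_of_foldl [CommSemiring K] {A : Submodule K (MvPolynomial σ K)} {k : ℕ}
    {g : MvPolynomial σ K}
    (h : ∀ L : List σ, L.length = k → L.foldl (fun g i => pderiv i g) g ∈ A) :
    g ∈ prolongation A k := by
  induction k generalizing g with
  | zero => exact h [] rfl
  | succ k ih =>
    exact mem_prolongation_succ.2 fun i => ih fun L hL => h (i :: L) (by simp [hL])

/-- The chain rule for substitution of polynomials into a polynomial. -/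
theorem pderiv_aeval [CommSemiring K] [Fintype σ] (u : σ → MvPolynomial τ K) (j : τ)
    (f : MvPolynomial σ K) :
    pderiv j (aeval u f) = ∑ i, aeval u (pderiv i f) * pderiv j (u i) := by
  classical
  induction f using MvPolynomial.induction_on with
  | C a => simp [algebraMap_eq]
  | add p q hp hq => simp only [map_add, hp, hq, add_mul, Finset.sum_add_distrib]
  | mul_X p i hp =>
    simp only [map_mul, aeval_X, Derivation.leibniz, smul_eq_mul, hp, pderiv_X, map_add,
      add_mul, Finset.sum_add_distrib, Finset.mul_sum]
    congr 1
    · rw [Finset.sum_eq_single i]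
      · simp
      · intro b _ hb
        simp [hb.symm]
      · simp
    · exact Finset.sum_congr rfl fun _ _ => by ring

/-- Linear substitutions pull prolongations back to prolongations. -/
theorem aeval_mem_prolongation [CommSemiring K] [Fintype σ] [Fintype τ] (x : τ → σ → K)
    {A : Submodule K (MvPolynomial σ K)} {B : Submodule K (MvPolynomial τ K)}
    (hAB : ∀ g ∈ A, aeval (fun i => ∑ j, C (x j i) * X j) g ∈ B) {k : ℕ} :
    ∀ f ∈ prolongation A k, aeval (fun i => ∑ j, C (x j i) * X j) f ∈ prolongation B k := by
  classical
  induction k with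
  | zero => exact hAB
  | succ k ih =>
    intro f hf
    refine mem_prolongation_succ.2 fun j => ?_
    rw [pderiv_aeval]
    refine Submodule.sum_mem _ fun i _ => ?_
    have hu : pderiv j (∑ l, C (x l i) * X l : MvPolynomial τ K) = C (x j i) := by
      rw [map_sum, Finset.sum_eq_single j]
      · simp
      · intro b _ hb
        simp [pderiv_X_of_ne hb]
      · simp
    rw [hu, mul_comm, ← smul_eq_C_mul]
    exact Submodule.smul_mem _ _ (ih _ (mem_prolongation_succ.1 hf i))

theorem IsHomogeneous.eval_single_one [CommSemiring K] [Fintype τ] [DecidableEq τ]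
    {G : MvPolynomial τ K} {d : ℕ} (hG : G.IsHomogeneous d) (j : τ) :
    eval (Pi.single j 1) G = coeff (Finsupp.single j d) G := by
  rw [eval_eq', Finset.sum_eq_single (Finsupp.single j d)]
  · rw [Finset.prod_eq_one, mul_one]
    intro i _
    by_cases h : i = j
    · subst h; simp
    · simp [Ne.symm h]
  · intro m hm hne
    obtain ⟨i, hij, hi⟩ : ∃ i, i ≠ j ∧ m i ≠ 0 := by
      by_contra! hall
      refine hne ?_
      have hdeg : m.degree = d := by
        by_contra hd
        exact mem_support_iff.1 hm (hG.coeff_eq_zero hd)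
      have hms : m = Finsupp.single j (m j) := by
        ext i
        by_cases h : i = j
        · subst h; simp
        · simp [Ne.symm h, hall i h]
      rw [hms, Finsupp.degree_single] at hdeg
      rw [hms, hdeg]
    rw [Finset.prod_eq_zero (Finset.mem_univ i), mul_zero]
    simp [hij, hi]
  · intro h
    rw [notMem_support_iff.1 h, zero_mul]

/-- If the derivatives of order `k` of a form of degree `k + 2` vanish at a coordinate point,
then the form has no monomial divisible by the square of that coordinate. -/
theorem coeff_eq_zero_of_mem_prolongation [Field K] [CharZero K] [Fintype τ] [DecidableEq τ]
    {A : Submodule K (MvPolynomial τ K)} {j : τ} (hA : ∀ g ∈ A, eval (Pi.single j 1) g = 0)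
    {k : ℕ} {G : MvPolynomial τ K} (hG : G.IsHomogeneous (k + 2)) (h : G ∈ prolongation A k)
    {m : τ →₀ ℕ} (hm : 2 ≤ m j) : coeff m G = 0 := by
  by_cases hdeg : m.degree = k + 2
  swap
  · exact hG.coeff_eq_zero hdeg
  obtain ⟨m, rfl⟩ : ∃ m', m = m' + Finsupp.single j 2 :=
    ⟨m - Finsupp.single j 2, (tsub_add_cancel_of_le (Finsupp.single_le_iff.2 hm)).symm⟩
  replace hdeg : m.degree = k := by simpa using hdeg
  clear hm
  induction k generalizing G m with
  | zero =>
    rw [(Finsupp.degree_eq_zero_iff m).1 hdeg, zero_add, ← hG.eval_single_one]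
    exact hA G h
  | succ k ih =>
    obtain ⟨i, hi⟩ : ∃ i, m i ≠ 0 := by
      by_contra! hall
      rw [(Finsupp.ext hall : m = 0)] at hdeg
      simp at hdeg
    obtain ⟨m, rfl⟩ : ∃ m', m = m' + Finsupp.single i 1 :=
      ⟨m - Finsupp.single i 1, (tsub_add_cancel_of_le
        (Finsupp.single_le_iff.2 (Nat.one_le_iff_ne_zero.2 hi))).symm⟩
    have key := ih (G := pderiv i G) (by simpa using hG.pderiv) (mem_prolongation_succ.1 h i) m
      (by simpa using hdeg)
    rw [coeff_pderiv, add_right_comm] at key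
    exact (mul_eq_zero.1 key).resolve_right (Nat.cast_add_one_ne_zero _)

end MvPolynomial


/-- Landsberg–Manivel, containment of the prolongation in the secant ideal: if all
iterated partial derivatives of order `r - 1` of a homogeneous polynomial `f` of degree
`r + 1` vanish on a cone `S`, then `f` vanishes on all sums of `r` elements of `S`. -/
theorem prolongation_vanishes_on_secant
    {n : ℕ} (hn : 1 ≤ n) (S : Set (Fin n → ℂ))
    (hcone : ∀ (c : ℂ), ∀ x ∈ S, c • x ∈ S)
    {r : ℕ} (hr : 2 ≤ r)
    (f : MvPolynomial (Fin n) ℂ) (hf : f.IsHomogeneous (r + 1))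
    (hder : ∀ L : List (Fin n), L.length = r - 1 → ∀ s ∈ S,
      MvPolynomial.eval s (L.foldl (fun g i => MvPolynomial.pderiv i g) f) = 0) :
    ∀ x : Fin r → (Fin n → ℂ), (∀ j, x j ∈ S) →
      MvPolynomial.eval (∑ j, x j) f = 0 := by
  intro x hx
  classical
  obtain ⟨k, rfl⟩ : ∃ k, r = k + 1 := ⟨r - 1, by omega⟩
  let A : Submodule ℂ (MvPolynomial (Fin n) ℂ) :=
    ⨅ s ∈ S, LinearMap.ker (MvPolynomial.aeval s).toLinearMap
  let B : Submodule ℂ (MvPolynomial (Fin (k + 1)) ℂ) :=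
    ⨅ j, LinearMap.ker (MvPolynomial.aeval (Pi.single j 1 : Fin (k + 1) → ℂ)).toLinearMap
  have hA : ∀ g, g ∈ A ↔ ∀ s ∈ S, MvPolynomial.eval s g = 0 := by
    intro g
    simp [A, Submodule.mem_iInf, MvPolynomial.aeval_eq_eval]
  have hB : ∀ g, g ∈ B ↔ ∀ j, MvPolynomial.eval (Pi.single j 1) g = 0 := by
    intro g
    simp [B, Submodule.mem_iInf, MvPolynomial.aeval_eq_eval]
  let u : Fin n → MvPolynomial (Fin (k + 1)) ℂ :=
    fun i => ∑ j, MvPolynomial.C (x j i) * MvPolynomial.X j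
  have eval_u : ∀ (t : Fin (k + 1) → ℂ) (g : MvPolynomial (Fin n) ℂ),
      MvPolynomial.eval t (MvPolynomial.aeval u g) = MvPolynomial.eval (∑ j, t j • x j) g := by
    intro t g
    induction g using MvPolynomial.induction_on with
    | C a => simp
    | add p q hp hq => simp only [map_add, hp, hq]
    | mul_X p i hp =>
      rw [map_mul, map_mul, map_mul, hp, MvPolynomial.aeval_X]
      simp [u, mul_comm]
  have hAB : ∀ g ∈ A, MvPolynomial.aeval u g ∈ B := by
    intro g hg
    rw [hB]
    intro j
    rw [eval_u]
    simpa [Pi.single_apply] using (hA g).1 hg (x j) (hx j)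
  have hG := MvPolynomial.aeval_mem_prolongation x hAB f
    (MvPolynomial.mem_prolongation_of_foldl (k := k) fun L hL =>
      (hA _).2 (hder L (by simpa using hL)))
  have hhom : (MvPolynomial.aeval u f).IsHomogeneous (k + 2) := by
    have h := hf.aeval u (n := 1) fun i => MvPolynomial.IsHomogeneous.sum _ _ _ fun j _ =>
      MvPolynomial.isHomogeneous_C_mul_X _ _
    simpa using h
  have hzero : MvPolynomial.aeval u f = 0 := by
    ext m
    rw [MvPolynomial.coeff_zero]
    by_cases hm : ∃ j, 2 ≤ m j
    · obtain ⟨j, hj⟩ := hm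
      exact MvPolynomial.coeff_eq_zero_of_mem_prolongation (fun g hg => (hB g).1 hg j) hhom hG hj
    · push Not at hm
      refine hhom.coeff_eq_zero fun hdeg => ?_
      have hle : m.degree ≤ k + 1 := by
        rw [Finsupp.degree_eq_sum]
        refine (Finset.sum_le_card_nsmul _ _ 1 fun j _ => Nat.le_of_lt_succ (hm j)).trans ?_
        simp
      omega
  have h := eval_u 1 f
  rw [hzero, map_zero] at h
  simpa using h.symm
end

section
/- Let n ≥ 1, let S ⊆ (Fin n → ℂ) be a subset closed under scalar multiplication whose ℂ-linear span is all of Fin n → ℂ. Let r ≥ 2 and let f ∈ MvPolynomial (Fin n) ℂ be homogeneous of degree r + 1 such that f(x₁ + x₂ + ⋯ + x_r) = 0 for all x₁, …, x_r ∈ S. Then every iterated partial derivative of f of total order r − 1 vanishes at every point of S. -/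
open MvPolynomial in
/-- The chain rule for the restriction of a multivariate polynomial to the line `x + t • y`. -/
theorem MvPolynomial.eval_derivative_aeval_line {σ R : Type*} [Fintype σ] [CommRing R]
    (g : MvPolynomial σ R) (x y : σ → R) :
    (Polynomial.derivative (aeval (fun i => Polynomial.C (x i) + Polynomial.C (y i) * Polynomial.X)
      g)).eval 0 = ∑ i, y i * eval x (pderiv i g) := by
  classical
  have h0 (p : MvPolynomial σ R) : (aeval (fun i => Polynomial.C (x i) +
      Polynomial.C (y i) * Polynomial.X) p).eval 0 = eval x p := by
    induction p using MvPolynomial.induction_on with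
    | C a => simp
    | add p q hp hq => simp [hp, hq]
    | mul_X p i hp => simp [hp]
  induction g using MvPolynomial.induction_on with
  | C a => simp
  | add p q hp hq => simp [hp, hq, mul_add, Finset.sum_add_distrib]
  | mul_X p i hp =>
    have hX (j : σ) : eval x (pderiv j (X i)) = if j = i then 1 else 0 := by
      rw [pderiv_X, Pi.single_apply]; split_ifs <;> simp_all
    simp only [map_mul, aeval_X, Polynomial.derivative_mul, Polynomial.eval_add,
      Polynomial.eval_mul, hp, h0, Derivation.leibniz, smul_eq_mul, map_add, hX, eval_X]
    simp [mul_add, Finset.sum_add_distrib, Finset.sum_mul, add_comm, mul_comm (eval x p),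
      mul_assoc, mul_comm (x i)]

open MvPolynomial in
/-- If `g` vanishes at `x + y` for all `y` in a cone spanning the ambient space, then all
first partial derivatives of `g` vanish at `x`. -/
theorem MvPolynomial.eval_pderiv_eq_zero_of_spanning_cone {σ K : Type*} [Fintype σ] [Field K]
    [Infinite K] {S : Set (σ → K)} (hcone : ∀ (c : K), ∀ x ∈ S, c • x ∈ S)
    (hspan : Submodule.span K S = ⊤) {g : MvPolynomial σ K} {x : σ → K}
    (hg : ∀ y ∈ S, eval (x + y) g = 0) (i : σ) : eval x (pderiv i g) = 0 := by
  classical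
  let φ : (σ → K) →ₗ[K] K := Fintype.linearCombination K fun i => eval x (pderiv i g)
  have hφ : Submodule.span K S ≤ LinearMap.ker φ := by
    refine Submodule.span_le.2 fun y hy => ?_
    have hp : aeval (fun i => Polynomial.C (x i) + Polynomial.C (y i) * Polynomial.X) g =
        (0 : Polynomial K) := by
      refine Polynomial.funext fun t => ?_
      rw [Polynomial.eval_zero, ← hg _ (hcone t y hy), ← Polynomial.coe_evalRingHom,
        aeval_def, hom_eval₂, eval, coe_eval₂Hom]
      congr 1
      · ext; simp
      · ext j; simp [mul_comm t]
    simpa [φ, hp, Fintype.linearCombination_apply] using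
      (eval_derivative_aeval_line g x y).symm
  have : φ (Pi.single i 1) = 0 := hφ (hspan ▸ Submodule.mem_top)
  simpa [φ, Fintype.linearCombination_apply, Pi.single_apply] using this

open MvPolynomial in
/-- If `f` vanishes on all sums of `L.length + 1` elements of a cone spanning the ambient space,
then the iterated partial derivative of `f` along `L` vanishes on the cone. -/
theorem MvPolynomial.eval_foldl_pderiv_eq_zero_of_spanning_cone {σ K : Type*} [Fintype σ]
    [Field K] [Infinite K] {S : Set (σ → K)} (hcone : ∀ (c : K), ∀ x ∈ S, c • x ∈ S)
    (hspan : Submodule.span K S = ⊤) (L : List σ) (f : MvPolynomial σ K)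
    (hf : ∀ x : Fin (L.length + 1) → σ → K, (∀ j, x j ∈ S) → eval (∑ j, x j) f = 0)
    {s : σ → K} (hs : s ∈ S) : eval s (L.foldl (fun g i => pderiv i g) f) = 0 := by
  induction L generalizing f with
  | nil => simpa using hf (fun _ => s) fun _ => hs
  | cons i L ih =>
    refine ih (pderiv i f) fun x hx =>
      eval_pderiv_eq_zero_of_spanning_cone hcone hspan (fun y hy => ?_) i
    rw [← Fin.sum_snoc]
    refine hf (Fin.snoc x y) fun j => ?_
    induction j using Fin.lastCases with
    | last => simpa using hy
    | cast j => simpa using hx j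

/-- Landsberg–Manivel, the other containment: for a nondegenerate cone `S` spanning the
ambient space, if a homogeneous polynomial `f` of degree `r + 1` vanishes on all sums of
`r` elements of `S`, then all iterated partial derivatives of `f` of order `r - 1`
vanish on `S`. -/
theorem secant_ideal_contained_in_prolongation
    {n : ℕ} (hn : 1 ≤ n) (S : Set (Fin n → ℂ))
    (hcone : ∀ (c : ℂ), ∀ x ∈ S, c • x ∈ S)
    (hspan : Submodule.span ℂ S = ⊤)
    {r : ℕ} (hr : 2 ≤ r)
    (f : MvPolynomial (Fin n) ℂ) (hf : f.IsHomogeneous (r + 1))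
    (hvan : ∀ x : Fin r → (Fin n → ℂ), (∀ j, x j ∈ S) →
      MvPolynomial.eval (∑ j, x j) f = 0) :
    ∀ L : List (Fin n), L.length = r - 1 → ∀ s ∈ S,
      MvPolynomial.eval s (L.foldl (fun g i => MvPolynomial.pderiv i g) f) = 0 := by
  intro L hL s hs
  obtain rfl : r = L.length + 1 := by omega
  exact MvPolynomial.eval_foldl_pderiv_eq_zero_of_spanning_cone hcone hspan L f hvan hs
end

section
/- Let E be a real vector space, Δ ⊆ E a finite subset with Δ = −Δ and 0 ∉ Δ, and Π ⊆ Δ a finite linearly independent subset such that the difference of any two distinct elements of Π does not lie in Δ. Let m : Π → ℤ assign to each α ∈ Π a positive integer m_α, set θ = Σ_{α∈Π} m_α • α, and assume θ ∈ Δ and θ + α ∉ Δ for all α ∈ Π. Let M = Π ∪ {−θ}. Then: (i) M is root-distinct, i.e., for all x, y ∈ M the difference x − y does not lie in Δ; (ii) −θ ∉ Π, so M has |Π| + 1 elements; (iii) M is a balanced simplex: assigning coefficient m_α to α ∈ Π and coefficient 1 to −θ gives positive integers with gcd 1 summing to zero, Σ m_α α + 1·(−θ) = 0, while no nonempty proper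 subset of M admits positive integers c with Σ c_ν ν = 0. Consequently b_M = 1 + Σ_{α∈Π} m_α, which is the Coxeter number h of the root system when Δ is an irreducible root system with simple roots Π and highest root θ. -/
open Finset in
/-- A finset obtained from a linearly independent one by adjoining a negative combination with
positive coefficients admits no positive dependency on a nonempty proper subset. -/
theorem not_exists_pos_dependency_of_ssubset_insert_neg
    {E : Type*} [AddCommGroup E] [Module ℝ E] [DecidableEq E] {Φ : Finset E}
    (hind : LinearIndepOn ℝ id (Φ : Set E)) {m : E → ℕ} (hm : ∀ α ∈ Φ, 0 < m α)
    {θ : E} (hθ : θ = ∑ α ∈ Φ, (m α : ℝ) • α) {S : Finset E}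
    (hS : S ⊂ insert (-θ) Φ) (hne : S.Nonempty) :
    ¬ ∃ c : E → ℕ, (∀ x ∈ S, 0 < c x) ∧ ∑ x ∈ S, (c x : ℝ) • x = 0 := by
  rintro ⟨c, hc, hsum⟩
  by_cases hmem : -θ ∈ S
  · obtain ⟨β, hβ, hβS⟩ := exists_of_ssubset hS
    have hβΦ : β ∈ Φ := (mem_insert.mp hβ).resolve_left fun h => hβS (h ▸ hmem)
    have hT : S.erase (-θ) ⊆ Φ := fun x hx =>
      (mem_insert.mp (hS.subset (mem_of_mem_erase hx))).resolve_left (ne_of_mem_erase hx)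
    have hrel : ∑ α ∈ Φ, ((if α ∈ S.erase (-θ) then (c α : ℝ) else 0) -
        (c (-θ) : ℝ) * m α) • id α = 0 := by
      simp only [id, sub_smul, sum_sub_distrib, mul_smul, ← smul_sum, ← hθ, ite_smul, zero_smul]
      rw [sum_ite_mem, inter_eq_right.mpr hT, sub_eq_add_neg, ← smul_neg,
        sum_erase_add _ _ hmem, hsum]
    have hβ0 := linearIndepOn_finset_iff.mp hind _ hrel β hβΦ
    have hpos : (0 : ℝ) < c (-θ) * m β := by
      exact_mod_cast Nat.mul_pos (hc _ hmem) (hm β hβΦ)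
    rw [if_neg fun h => hβS (mem_of_mem_erase h)] at hβ0
    linarith
  · have hT : S ⊆ Φ := (subset_insert_iff_of_notMem hmem).mp hS.subset
    obtain ⟨x, hx⟩ := hne
    have hx0 := linearIndepOn_finset_iff.mp (hind.mono (coe_subset.mpr hT)) _ hsum x hx
    exact (hc x hx).ne' (by exact_mod_cast hx0)

open Finset in
/-- The negative of a combination of linearly independent vectors with natural coefficients is
not one of these vectors. -/
theorem neg_sum_natCast_smul_notMem
    {E : Type*} [AddCommGroup E] [Module ℝ E] [DecidableEq E] {Φ : Finset E}
    (hind : LinearIndepOn ℝ id (Φ : Set E)) (m : E → ℕ) :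
    -∑ α ∈ Φ, (m α : ℝ) • α ∉ Φ := by
  intro hmem
  set θ := ∑ α ∈ Φ, (m α : ℝ) • α with hθ
  have hrel : ∑ α ∈ Φ, ((m α : ℝ) + if α = -θ then 1 else 0) • id α = 0 := by
    simp only [id, add_smul, sum_add_distrib, ite_smul, one_smul, zero_smul, sum_ite_eq',
      if_pos hmem, ← hθ, add_neg_cancel]
  have h := linearIndepOn_finset_iff.mp hind _ hrel _ hmem
  rw [if_pos rfl] at h
  have := (m (-θ)).cast_nonneg (α := ℝ)
  linarith


/-- Example: the simple roots together with minus the highest root form a root-distinct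
balanced simplex, with `b_M = 1 + ∑ m_α` the Coxeter number. -/
theorem simple_roots_with_minus_highest_root_balanced_simplex
    {E : Type*} [AddCommGroup E] [Module ℝ E] [DecidableEq E]
    (Δ : Set E) (hfin : Δ.Finite) (hsym : ∀ x ∈ Δ, -x ∈ Δ) (h0 : (0 : E) ∉ Δ)
    (Φ : Finset E) (hsub : (Φ : Set E) ⊆ Δ)
    (hind : LinearIndependent ℝ (fun x : (Φ : Set E) => (x : E)))
    (hdiff : ∀ x ∈ Φ, ∀ y ∈ Φ, x ≠ y → x - y ∉ Δ)
    (m : E → ℕ) (hm : ∀ α ∈ Φ, 0 < m α)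
    (θ : E) (hθ : θ = ∑ α ∈ Φ, (m α : ℝ) • α)
    (hθΔ : θ ∈ Δ) (hθα : ∀ α ∈ Φ, θ + α ∉ Δ) :
    -- (i) M = Φ ∪ {-θ} is root-distinct
    (∀ x ∈ insert (-θ) Φ, ∀ y ∈ insert (-θ) Φ, x - y ∉ Δ) ∧
    -- (ii) -θ ∉ Φ, so M has #Φ + 1 elements
    -θ ∉ Φ ∧ (insert (-θ) Φ).card = Φ.card + 1 ∧
    -- (iii) M is a balanced simplex with coefficients m_α on Φ and 1 on -θ:
    (∀ x ∈ insert (-θ) Φ, 0 < if x = -θ then 1 else m x) ∧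
    (insert (-θ) Φ).gcd (fun x => if x = -θ then 1 else m x) = 1 ∧
    (∑ x ∈ insert (-θ) Φ, ((if x = -θ then 1 else m x : ℕ) : ℝ) • x = 0) ∧
    (∀ S ⊂ insert (-θ) Φ, S.Nonempty →
      ¬ ∃ c : E → ℕ, (∀ x ∈ S, 0 < c x) ∧ ∑ x ∈ S, (c x : ℝ) • x = 0) ∧
    -- b_M = 1 + ∑ m_α (the Coxeter number)
    ∑ x ∈ insert (-θ) Φ, (if x = -θ then 1 else m x) = 1 + ∑ α ∈ Φ, m α := by
  have hmem : -θ ∉ Φ := hθ ▸ neg_sum_natCast_smul_notMem hind m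
  have hcoeff : ∀ x ∈ Φ, (if x = -θ then 1 else m x) = m x :=
    fun x hx => if_neg fun h : x = -θ => hmem (h ▸ hx)
  refine ⟨?_, hmem, Finset.card_insert_of_notMem hmem, ?_, ?_, ?_,
    fun S hS hne => not_exists_pos_dependency_of_ssubset_insert_neg hind hm hθ hS hne, ?_⟩
  · intro x hx y hy
    rcases Finset.mem_insert.mp hx with rfl | hxΦ <;>
      rcases Finset.mem_insert.mp hy with rfl | hyΦ
    · simpa using h0
    · intro h
      refine hθα y hyΦ ?_
      simpa [add_comm] using hsym _ h
    · simpa [add_comm] using hθα x hxΦ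
    · by_cases hxy : x = y
      · simpa [hxy] using h0
      · exact hdiff x hxΦ y hyΦ hxy
  · intro x hx
    split_ifs with h
    · exact one_pos
    · exact hm x ((Finset.mem_insert.mp hx).resolve_left h)
  · simp [Finset.gcd_insert]
  · rw [Finset.sum_insert hmem, Finset.sum_congr rfl fun x hx => by rw [hcoeff x hx], ← hθ]
    simp
  · rw [Finset.sum_insert hmem, if_pos rfl, Finset.sum_congr rfl hcoeff]
end

section
/- Let n ≥ 2 and k ≥ 2 be integers. In ℝⁿ with standard basis e₁,…,eₙ, let ν_i = k • e_i − (k/n) • (e₁ + ⋯ + eₙ) for i = 1,…,n, and let Δ = {e_i − e_j : i ≠ j}. Then: (i) the set M = {ν₁,…,νₙ} has exactly n elements and is root-distinct with respect to Δ, i.e., ν_i − ν_j ∉ Δ for all i, j; (ii) Σ_{i=1}^n ν_i = 0, while for every nonempty proper subset S ⊊ {1,…,n} and every family of positive reals (c_i)_{i∈S} one has Σ_{i∈S} c_i ν_i ≠ 0. Hence M is a balanced simplex with all primitive coefficients equal to 1 and b_M = n. -/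
/-- The extreme weights of the representation `S^k ℂ^n` of `SL_n` (`k, n ≥ 2`) form a
root-distinct balanced `(n-1)`-simplex with respect to the root system of `SL_n`:
they are `n` distinct vectors, their pairwise differences avoid the roots, they sum to
zero, and no nonempty proper subset admits a vanishing positive combination. -/
theorem veronese_extreme_weights_balanced_simplex
    {n k : ℕ} (hn : 2 ≤ n) (hk : 2 ≤ k)
    (ν : Fin n → (Fin n → ℝ))
    (hν : ∀ i, ν i =
      (k : ℝ) • (Pi.single i (1 : ℝ) : Fin n → ℝ)
        - ((k : ℝ) / (n : ℝ)) • ∑ j, (Pi.single j (1 : ℝ) : Fin n → ℝ))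
    (Δ : Set (Fin n → ℝ))
    (hΔ : Δ = {d | ∃ i j : Fin n, i ≠ j ∧
      d = (Pi.single i (1 : ℝ) : Fin n → ℝ) - (Pi.single j (1 : ℝ) : Fin n → ℝ)}) :
    -- (i) M = {ν 1, ..., ν n} has n elements and is root-distinct
    (Finset.univ.image ν).card = n ∧
    (∀ i j : Fin n, ν i - ν j ∉ Δ) ∧
    -- (ii) the weights sum to zero, and no nonempty proper subset is positively dependent
    (∑ i, ν i = 0) ∧
    (∀ S : Finset (Fin n), S.Nonempty → S ≠ Finset.univ →
      ∀ c : Fin n → ℝ, (∀ i ∈ S, 0 < c i) → ∑ i ∈ S, c i • ν i ≠ 0) := by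
  classical
  have hk' : (2 : ℝ) ≤ k := by exact_mod_cast hk
  have hn' : (0 : ℝ) < n := by exact_mod_cast (by omega : 0 < n)
  have hν_apply : ∀ i l, ν i l = (if l = i then (k : ℝ) else 0) - (k : ℝ) / n := by
    intro i l
    simp [hν, Pi.single_apply, Finset.sum_apply]
  refine ⟨?_, ?_, ?_, ?_⟩
  · have hinj : Function.Injective ν := by
      intro i j hij
      by_contra hne
      have h := congrFun hij i
      rw [hν_apply, hν_apply, if_pos rfl, if_neg hne] at h
      linarith
    rw [Finset.card_image_of_injective _ hinj, Finset.card_univ, Fintype.card_fin]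
  · rw [hΔ]
    rintro i j ⟨a, b, hab, h⟩
    have h := congrFun h a
    simp only [Pi.sub_apply, hν_apply, Pi.single_apply, if_true, if_neg hab] at h
    split_ifs at h <;> linarith
  · ext l
    simp only [Finset.sum_apply, hν_apply, Finset.sum_sub_distrib, Finset.sum_ite_eq,
      Finset.mem_univ, if_true, Finset.sum_const, Finset.card_univ, Fintype.card_fin,
      nsmul_eq_mul, Pi.zero_apply]
    field_simp
    ring
  · intro S hS hSu c hc h
    obtain ⟨l, hl⟩ : ∃ l, l ∉ S := by
      by_contra! hall
      exact hSu (Finset.eq_univ_iff_forall.2 hall)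
    have h := congrFun h l
    rw [Finset.sum_apply, Pi.zero_apply] at h
    refine (Finset.sum_neg (fun i hi => ?_) hS).ne h
    have hli : l ≠ i := fun e => hl (e ▸ hi)
    rw [Pi.smul_apply, smul_eq_mul, hν_apply, if_neg hli, zero_sub]
    exact mul_neg_of_pos_of_neg (hc i hi) (neg_neg_of_pos (div_pos (by linarith) hn'))
end
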